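/- arXiv:1308.5289 — 3 statements merged into one kernel-verified Lean document; each statement's English description precedes it below -/
import Mathlib

section
/- Let U ⊆ Ũ be open subsets of ℝᵐ and let {fᵢ}_{i∈ℕ} be a countable family of smooth functions on U. Then there exists a smooth function α on Ũ such that α ≡ 0 on Ũ \ U, α(x) ≠ 0 for all x ∈ U, and for every i the function α·fᵢ extends to a smooth function on Ũ that vanishes identically on Ũ \ U. -/
open scoped ContDiff

section Tougeron

variable {E : Type*} [NormedAddCommGroup E] [NormedSpace ℝ E]

lemma ContDiff.mul_of_tsupport_subset {n : WithTop ℕ∞} {g f : E → ℝ} {U : Set E}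
    (hU : IsOpen U) (hg : ContDiff ℝ n g) (hgU : tsupport g ⊆ U) (hf : ContDiffOn ℝ n f U) :
    ContDiff ℝ n (g * f) := by
  rw [contDiff_iff_contDiffAt]
  intro x
  by_cases hx : x ∈ U
  · exact hg.contDiffAt.mul (hf.contDiffAt (hU.mem_nhds hx))
  · have hg0 : g =ᶠ[nhds x] 0 := notMem_tsupport_iff_eventuallyEq.1 fun h => hx (hgU h)
    refine (contDiffAt_const (c := (0 : ℝ))).congr_of_eventuallyEq ?_
    filter_upwards [hg0] with y hy
    simp [hy]

lemma IsOpen.exists_seq_contDiff_iUnion_support_eq [FiniteDimensional ℝ E] {U : Set E}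
    (hU : IsOpen U) :
    ∃ g : ℕ → E → ℝ, (∀ n, ContDiff ℝ ∞ (g n)) ∧ (∀ n, HasCompactSupport (g n)) ∧
      (∀ n, tsupport (g n) ⊆ U) ∧ (∀ n x, 0 ≤ g n x) ∧ ∀ x ∈ U, ∃ n, g n x ≠ 0 := by
  let S : Set (E → ℝ) :=
    {g | ContDiff ℝ ∞ g ∧ HasCompactSupport g ∧ tsupport g ⊆ U ∧ ∀ x, 0 ≤ g x}
  have h_zero : (0 : E → ℝ) ∈ S :=
    ⟨contDiff_const, HasCompactSupport.zero, by simp [tsupport], fun _ => le_rfl⟩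
  obtain ⟨T, hT_count, hT⟩ := TopologicalSpace.isOpen_iUnion_countable
    (fun g : S => Function.support (g : E → ℝ)) fun g => g.2.1.continuous.isOpen_support
  obtain ⟨g, hg⟩ := (hT_count.insert ⟨0, h_zero⟩).exists_eq_range (Set.insert_nonempty _ _)
  refine ⟨fun n => g n, fun n => (g n).2.1, fun n => (g n).2.2.1, fun n => (g n).2.2.2.1,
    fun n => (g n).2.2.2.2, fun x hx => ?_⟩
  obtain ⟨b, hbU, hb_compact, hb_smooth, hb_range, hbx⟩ :=
    exists_contDiff_tsupport_subset (n := ⊤) (hU.mem_nhds hx)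
  have hx_mem : x ∈ ⋃ g : S, Function.support (g : E → ℝ) :=
    Set.mem_iUnion.2 ⟨⟨b, hb_smooth, hb_compact, hbU, fun y => (hb_range ⟨y, rfl⟩).1⟩, by
      simp [hbx]⟩
  rw [← hT] at hx_mem
  obtain ⟨c, hcT, hc⟩ := Set.mem_iUnion₂.1 hx_mem
  obtain ⟨n, rfl⟩ : c ∈ Set.range g := hg ▸ Set.mem_insert_of_mem _ hcT
  exact ⟨n, hc⟩

lemma exists_pos_forall_contDiff_tsum_mul {G : ℕ → ℕ → E → ℝ}
    (hG : ∀ n j, ContDiff ℝ ∞ (G n j)) (hGc : ∀ n j, HasCompactSupport (G n j)) :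
    ∃ r : ℕ → ℝ, (∀ n, 0 < r n) ∧ ∀ j, (∀ x, Summable fun n => r n * G n j x) ∧
      ContDiff ℝ ∞ fun x => ∑' n, r n * G n j x := by
  have h_bound : ∀ n, ∃ r : ℝ, 0 < r ∧ ∀ i ≤ n, ∀ j ≤ n, ∀ x,
      ‖iteratedFDeriv ℝ i (r • G n j) x‖ ≤ (1 / 2 : ℝ) ^ n := by
    intro n
    have h_bdd : ∀ i j, ∃ R, ∀ x, ‖iteratedFDeriv ℝ i (G n j) x‖ ≤ R := by
      intro i j
      obtain ⟨R, hR⟩ := ((hG n j).continuous_iteratedFDeriv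
        (mod_cast le_top)).norm.bddAbove_range_of_hasCompactSupport
        (((hGc n j).iteratedFDeriv i).comp_left norm_zero)
      exact ⟨R, fun x => hR ⟨x, rfl⟩⟩
    choose R hR using h_bdd
    obtain ⟨M, hM⟩ := ((Finset.range (n + 1) ×ˢ Finset.range (n + 1)).image
      fun p => R p.1 p.2).exists_le
    have hM_pos : 0 < max M 1 := lt_max_of_lt_right one_pos
    refine ⟨(max M 1)⁻¹ * (1 / 2) ^ n, by positivity, fun i hi j hj x => ?_⟩
    have hRM : R i j ≤ max M 1 := (hM _ (Finset.mem_image.2 ⟨(i, j), by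
      simp only [Finset.mem_product, Finset.mem_range]; lia, rfl⟩)).trans (le_max_left _ _)
    rw [iteratedFDeriv_const_smul_apply ((hG n j).contDiffAt.of_le (mod_cast le_top)),
      norm_smul, Real.norm_of_nonneg (by positivity)]
    calc
      _ ≤ (max M 1)⁻¹ * (1 / 2) ^ n * max M 1 := by gcongr; exact (hR i j x).trans hRM
      _ = (1 / 2) ^ n := by field_simp
  choose r hr_pos hr using h_bound
  refine ⟨r, hr_pos, fun j => ⟨fun x => ?_, ?_⟩⟩
  · refine summable_geometric_two.of_norm_bounded_eventually_nat ?_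
    filter_upwards [Filter.eventually_ge_atTop j] with n hn
    simpa only [norm_iteratedFDeriv_zero, Pi.smul_apply, smul_eq_mul] using
      hr n 0 n.zero_le j hn x
  · refine contDiff_tsum_of_eventually (fun n => (hG n j).const_smul (r n))
      (fun _ _ => summable_geometric_two) fun i _ => ?_
    rw [Nat.cofinite_eq_atTop]
    filter_upwards [Filter.eventually_ge_atTop i, Filter.eventually_ge_atTop j] with n hi hj x
    exact hr n i hi j hj x

end Tougeron


/-- Tougeron's extension lemma: given open sets `U ⊆ Ũ` in `ℝᵐ` and a countable family
`{fᵢ}` of smooth functions on `U`, there is a smooth function `α` on `Ũ` vanishing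
exactly on `Ũ \ U` such that each `α · fᵢ` extends to a smooth function on `Ũ`
vanishing identically on `Ũ \ U`. -/
theorem tougeron_extension (m : ℕ) (U Utilde : Set (Fin m → ℝ))
    (hU : IsOpen U) (hUtilde : IsOpen Utilde) (hsub : U ⊆ Utilde)
    (f : ℕ → (Fin m → ℝ) → ℝ) (hf : ∀ i, ContDiffOn ℝ (⊤ : ℕ∞) (f i) U) :
    ∃ α : (Fin m → ℝ) → ℝ, ContDiffOn ℝ (⊤ : ℕ∞) α Utilde ∧
      (∀ x ∈ Utilde \ U, α x = 0) ∧ (∀ x ∈ U, α x ≠ 0) ∧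
      ∀ i, ∃ f' : (Fin m → ℝ) → ℝ, ContDiffOn ℝ (⊤ : ℕ∞) f' Utilde ∧
        (∀ x ∈ U, f' x = α x * f i x) ∧ (∀ x ∈ Utilde \ U, f' x = 0) := by
  obtain ⟨g, hg, hgc, hgU, hg_nonneg, hg_ne⟩ := hU.exists_seq_contDiff_iUnion_support_eq
  let F : ℕ → (Fin m → ℝ) → ℝ := fun j => Nat.casesOn j 1 f
  have hF : ∀ j, ContDiffOn ℝ (⊤ : ℕ∞) (F j) U
    | 0 => contDiffOn_const
    | j + 1 => hf j
  obtain ⟨r, hr_pos, hr⟩ := exists_pos_forall_contDiff_tsum_mul (G := fun n j => g n * F j)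
    (fun n j => (hg n).mul_of_tsupport_subset hU (hgU n) (hF j)) fun n j => (hgc n).mul_right
  have hg_zero : ∀ n, ∀ x ∉ U, g n x = 0 := fun n x hx =>
    image_eq_zero_of_notMem_tsupport fun h => hx (hgU n h)
  have h_sum : ∀ x, Summable fun n => r n * g n x := fun x => by
    simpa [F] using (hr 0).1 x
  refine ⟨fun x => ∑' n, r n * g n x, ?_, fun x hx => by simp [hg_zero _ x hx.2],
    fun x hx => ?_, fun i => ⟨_, (hr (i + 1)).2.contDiffOn, fun x _ => ?_,
      fun x hx => by simp [hg_zero _ x hx.2]⟩⟩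
  · simpa [F] using (hr 0).2.contDiffOn
  · obtain ⟨n, hn⟩ := hg_ne x hx
    exact ((h_sum x).tsum_pos (fun k => mul_nonneg (hr_pos k).le (hg_nonneg k x)) n
      (mul_pos (hr_pos n) ((hg_nonneg n x).lt_of_ne' hn))).ne'
  · simp only [F, Pi.mul_apply, ← mul_assoc, tsum_mul_right]
end

section
/- Let U ⊆ Ũ be open subsets of ℝᵐ. Then C^∞(U) is a flat module over C^∞(Ũ), where the module structure is given by restriction of functions. -/
/-- The ring `C^∞(U)` of smooth real-valued functions on an open set `U ⊆ ℝᵐ`,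
realized as the subring of functions `U → ℝ` admitting a smooth extension
(`ContDiffOn` representative) on `U`. -/
def Cinf (m : ℕ) (U : Set (Fin m → ℝ)) : Subring (↥U → ℝ) where
  carrier := {g | ∃ f : (Fin m → ℝ) → ℝ, ContDiffOn ℝ (⊤ : ℕ∞) f U ∧ ∀ x : ↥U, g x = f x}
  mul_mem' := by
    rintro a b ⟨fa, hfa, ha⟩ ⟨fb, hfb, hb⟩
    exact ⟨fa * fb, hfa.mul hfb, fun x => by simp [Pi.mul_apply, ha x, hb x]⟩
  one_mem' := ⟨fun _ => 1, contDiffOn_const, fun x => rfl⟩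
  add_mem' := by
    rintro a b ⟨fa, hfa, ha⟩ ⟨fb, hfb, hb⟩
    exact ⟨fa + fb, hfa.add hfb, fun x => by simp [Pi.add_apply, ha x, hb x]⟩
  zero_mem' := ⟨fun _ => 0, contDiffOn_const, fun x => rfl⟩
  neg_mem' := by
    rintro a ⟨fa, hfa, ha⟩
    exact ⟨-fa, hfa.neg, fun x => by simp [Pi.neg_apply, ha x]⟩

/-- The restriction ring homomorphism `C^∞(Ũ) → C^∞(U)` for `U ⊆ Ũ`. -/
def CinfRes (m : ℕ) (U Utilde : Set (Fin m → ℝ)) (h : U ⊆ Utilde) :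
    Cinf m Utilde →+* Cinf m U where
  toFun g := ⟨fun x => g.1 ⟨x.1, h x.2⟩, by
    obtain ⟨f, hf, hg⟩ := g.2
    exact ⟨f, hf.mono h, fun x => hg ⟨x.1, h x.2⟩⟩⟩
  map_one' := rfl
  map_mul' _ _ := rfl
  map_zero' := rfl
  map_add' _ _ := rfl

open Set Function Filter Topology
open scoped ContDiff NNReal

/-- A sequence of compactly supported smooth functions can be rescaled by positive constants
so that the resulting series converges to a smooth function. -/
theorem exists_pos_contDiff_tsum_smul {E F : Type*} [NormedAddCommGroup E] [NormedSpace ℝ E]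
    [NormedAddCommGroup F] [NormedSpace ℝ F] [CompleteSpace F] (g : ℕ → E → F)
    (hg : ∀ n, ContDiff ℝ ∞ (g n)) (hc : ∀ n, HasCompactSupport (g n)) :
    ∃ r : ℕ → ℝ, (∀ n, 0 < r n) ∧ (∀ x, Summable fun n => r n • g n x) ∧
      ContDiff ℝ ∞ fun x => ∑' n, r n • g n x := by
  obtain ⟨δ, δpos, c, δc, -⟩ := NNReal.exists_pos_sum_of_countable (one_ne_zero (α := ℝ≥0)) ℕ
  have δs : Summable fun n => (δ n : ℝ) := (NNReal.hasSum_coe.2 δc).summable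
  have key : ∀ n : ℕ, ∃ r : ℝ, 0 < r ∧
      ∀ i ≤ n, ∀ x, ‖iteratedFDeriv ℝ i (r • g n) x‖ ≤ δ n := by
    intro n
    have bdd : ∀ i, ∃ R, ∀ x, ‖iteratedFDeriv ℝ i (g n) x‖ ≤ R := by
      intro i
      have : BddAbove (range fun x => ‖iteratedFDeriv ℝ i (g n) x‖) := by
        apply ((hg n).continuous_iteratedFDeriv
          (mod_cast le_top)).norm.bddAbove_range_of_hasCompactSupport
        exact ((hc n).iteratedFDeriv i).comp_left norm_zero
      obtain ⟨R, hR⟩ := this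
      exact ⟨R, fun x => hR (mem_range_self _)⟩
    choose R hR using bdd
    obtain ⟨M, hM⟩ := ((Finset.range (n + 1)).image R).bddAbove
    have δnpos : 0 < δ n := δpos n
    refine ⟨(max M 1)⁻¹ * δ n, by positivity, fun i hi x => ?_⟩
    have hRM : R i ≤ max M 1 :=
      (hM (Finset.mem_coe.2 (Finset.mem_image_of_mem R (by simp; lia)))).trans (le_max_left _ _)
    calc
      ‖iteratedFDeriv ℝ i (((max M 1)⁻¹ * δ n) • g n) x‖
          = ‖((max M 1)⁻¹ * δ n) • iteratedFDeriv ℝ i (g n) x‖ := by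
        rw [iteratedFDeriv_const_smul_apply]
        exact (hg n).contDiffAt.of_le (mod_cast le_top)
      _ = (max M 1)⁻¹ * δ n * ‖iteratedFDeriv ℝ i (g n) x‖ := by
        rw [norm_smul, Real.norm_of_nonneg]; positivity
      _ ≤ (max M 1)⁻¹ * δ n * max M 1 := by gcongr; exact (hR i x).trans hRM
      _ = δ n := by
        have : max M 1 ≠ 0 := by positivity
        field_simp
  choose r rpos hr using key
  refine ⟨r, rpos, fun x => .of_norm_bounded δs fun n => ?_, ?_⟩
  · simpa only [norm_iteratedFDeriv_zero, Pi.smul_apply] using hr n 0 (Nat.zero_le n) x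
  · refine contDiff_tsum_of_eventually (fun k => (hg k).const_smul (r k)) (fun k _ => δs) ?_
    intro i _
    simp only [Nat.cofinite_eq_atTop, Filter.eventually_atTop]
    exact ⟨i, fun n hn x => hr _ _ hn _⟩

/-- An open set is covered by the supports of a sequence of nonnegative smooth functions
which are compactly supported in it. -/
theorem IsOpen.exists_seq_contDiff_cover {E : Type*} [NormedAddCommGroup E] [NormedSpace ℝ E]
    [FiniteDimensional ℝ E] {s : Set E} (hs : IsOpen s) :
    ∃ g : ℕ → E → ℝ, (∀ n, tsupport (g n) ⊆ s) ∧ (∀ n, HasCompactSupport (g n)) ∧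
      (∀ n, ContDiff ℝ ∞ (g n)) ∧ (∀ n x, 0 ≤ g n x) ∧ ∀ x ∈ s, ∃ n, 0 < g n x := by
  let ι := {f : E → ℝ // tsupport f ⊆ s ∧ HasCompactSupport f ∧ ContDiff ℝ ∞ f ∧ ∀ x, 0 ≤ f x}
  obtain ⟨T, T_count, hT⟩ :=
    TopologicalSpace.isOpen_iUnion_countable (fun f : ι => support (f : E → ℝ))
      fun f => f.2.2.2.1.continuous.isOpen_support
  let z : ι := ⟨0, by simp, HasCompactSupport.zero, contDiff_const, fun _ => le_rfl⟩
  obtain ⟨g, hg⟩ := (T_count.insert z).exists_eq_range (insert_nonempty z T)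
  refine ⟨fun n => (g n).1, fun n => (g n).2.1, fun n => (g n).2.2.1, fun n => (g n).2.2.2.1,
    fun n => (g n).2.2.2.2, fun x hx => ?_⟩
  obtain ⟨f, hfs, hfc, hfd, hfr, hfx⟩ :=
    exists_contDiff_tsupport_subset (n := ⊤) (hs.mem_nhds hx)
  let f' : ι := ⟨f, hfs, hfc, hfd, fun y => (hfr (mem_range_self y)).1⟩
  have hmem : x ∈ ⋃ f : ι, support (f : E → ℝ) :=
    mem_iUnion_of_mem f' (by simp [f', hfx])
  rw [← hT] at hmem
  obtain ⟨i, hiT, hi⟩ := mem_iUnion₂.1 hmem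
  obtain ⟨n, rfl⟩ : i ∈ range g := hg ▸ mem_insert_of_mem z hiT
  exact ⟨n, lt_of_le_of_ne ((g n).2.2.2.2 x) (Ne.symm hi)⟩

/-- The product of a smooth function supported in an open set with a function that is smooth
on that set is smooth. -/
theorem ContDiff.mul_of_tsupport_subset_s3 {E : Type*} [NormedAddCommGroup E] [NormedSpace ℝ E]
    {n : WithTop ℕ∞} {s : Set E} (hs : IsOpen s) {χ f : E → ℝ} (hχ : ContDiff ℝ n χ)
    (hχs : tsupport χ ⊆ s) (hf : ContDiffOn ℝ n f s) : ContDiff ℝ n fun x => χ x * f x := by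
  refine contDiff_iff_contDiffAt.2 fun x => ?_
  by_cases hx : x ∈ s
  · exact hχ.contDiffAt.mul (hf.contDiffAt (hs.mem_nhds hx))
  · have h0 : χ =ᶠ[𝓝 x] 0 := notMem_tsupport_iff_eventuallyEq.1 fun h => hx (hχs h)
    refine (contDiffAt_const (c := (0 : ℝ))).congr_of_eventuallyEq ?_
    filter_upwards [h0] with y hy
    simp [hy]

/-- A function which is smooth on an open set `s` is, on `s`, a quotient of two globally smooth
functions, where the denominator is positive on `s` and vanishes outside `s`. -/
theorem ContDiffOn.exists_contDiff_mul_eq {E : Type*} [NormedAddCommGroup E] [NormedSpace ℝ E]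
    [FiniteDimensional ℝ E] {s : Set E} (hs : IsOpen s) {f : E → ℝ} (hf : ContDiffOn ℝ ∞ f s) :
    ∃ d F : E → ℝ, ContDiff ℝ ∞ d ∧ ContDiff ℝ ∞ F ∧ (∀ x ∈ s, 0 < d x) ∧ (∀ x ∉ s, d x = 0) ∧
      ∀ x, F x = d x * f x := by
  obtain ⟨g, gs, gc, gd, g0, gpos⟩ := hs.exists_seq_contDiff_cover
  obtain ⟨r, rpos, rsum, rd⟩ := exists_pos_contDiff_tsum_smul (fun n x => (g n x, g n x * f x))
    (fun n => (gd n).prodMk ((gd n).mul_of_tsupport_subset_s3 hs (gs n) hf))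
    (fun n => (gc n).mono fun x hx => by
      contrapose! hx
      simp_all)
  have S1 : ∀ x, Summable fun n => r n * g n x := fun x =>
    (rsum x).map (ContinuousLinearMap.fst ℝ ℝ ℝ) (ContinuousLinearMap.fst ℝ ℝ ℝ).continuous
  have h1 : ∀ x, (∑' n, r n • (g n x, g n x * f x)).1 = ∑' n, r n * g n x := fun x =>
    (ContinuousLinearMap.fst ℝ ℝ ℝ).map_tsum (rsum x)
  refine ⟨fun x => (∑' n, r n • (g n x, g n x * f x)).1,
    fun x => (∑' n, r n • (g n x, g n x * f x)).2, rd.fst, rd.snd, ?_, ?_, ?_⟩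
  · intro x hx
    obtain ⟨n, hn⟩ := gpos x hx
    beta_reduce
    rw [h1]
    exact (S1 x).tsum_pos (fun i => mul_nonneg (rpos i).le (g0 i x)) n (mul_pos (rpos n) hn)
  · intro x hx
    have : ∀ n, g n x = 0 := fun n => image_eq_zero_of_notMem_tsupport fun h => hx (gs n h)
    simp [this]
  · intro x
    have h2 : (∑' n, r n • (g n x, g n x * f x)).2 = ∑' n, r n * (g n x * f x) :=
      (ContinuousLinearMap.snd ℝ ℝ ℝ).map_tsum (rsum x)
    simp only [h1 x, h2, ← mul_assoc, tsum_mul_right]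

namespace Cinf

variable {m : ℕ} {U V : Set (Fin m → ℝ)}

/-- A nowhere vanishing smooth function is invertible. -/
theorem isUnit_of_ne_zero {g : Cinf m U} (hg : ∀ x, g.1 x ≠ 0) : IsUnit g := by
  obtain ⟨f, hf, hgf⟩ := g.2
  refine IsUnit.of_mul_eq_one ⟨fun x => (g.1 x)⁻¹, fun x => (f x)⁻¹, hf.inv fun x hx => ?_,
    fun x => congrArg (·⁻¹) (hgf x)⟩ ?_
  · simpa [← hgf ⟨x, hx⟩] using hg ⟨x, hx⟩
  · ext x
    exact mul_inv_cancel₀ (hg x)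

/-- The restriction of a globally smooth function. -/
def ofContDiff (V : Set (Fin m → ℝ)) (f : (Fin m → ℝ) → ℝ) (hf : ContDiff ℝ ∞ f) : Cinf m V :=
  ⟨fun x => f x, f, hf.contDiffOn, fun _ => rfl⟩

/-- For `U` open, `C^∞(U)` is the localization of `C^∞(V)` at the functions which become
invertible on `U`. -/
theorem isLocalization (hU : IsOpen U) (h : U ⊆ V) :
    letI : Algebra (Cinf m V) (Cinf m U) := (CinfRes m U V h).toAlgebra
    IsLocalization ((IsUnit.submonoid (Cinf m U)).comap (CinfRes m U V h)) (Cinf m U) := by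
  let : Algebra (Cinf m V) (Cinf m U) := (CinfRes m U V h).toAlgebra
  refine ⟨⟨fun s => s.2, fun g => ?_, fun {a b} hab => ?_⟩⟩
  · obtain ⟨f, hf, hgf⟩ := g.2
    obtain ⟨d, F, hd, hF, hpos, -, hdF⟩ := hf.exists_contDiff_mul_eq hU
    refine ⟨⟨ofContDiff V F hF, ofContDiff V d hd,
      isUnit_of_ne_zero fun x => (hpos x x.2).ne'⟩, ?_⟩
    ext x
    change g.1 x * d x = F x
    rw [hgf, hdF, mul_comm]
  · obtain ⟨d, -, hd, -, hpos, hzero, -⟩ :=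
      (contDiffOn_const (c := (0 : ℝ))).exists_contDiff_mul_eq hU
    refine ⟨⟨ofContDiff V d hd, isUnit_of_ne_zero fun x => (hpos x x.2).ne'⟩, ?_⟩
    ext x
    change d x * a.1 x = d x * b.1 x
    by_cases hx : (x : Fin m → ℝ) ∈ U
    · exact congrArg (d x * ·) (congrFun (congrArg Subtype.val hab) ⟨x, hx⟩)
    · simp [hzero x hx]

end Cinf

/-- For open sets `U ⊆ Ũ` in `ℝᵐ`, the ring `C^∞(U)` is a flat module over `C^∞(Ũ)`,
the module structure being given by restriction of functions. -/
theorem cinf_flat (m : ℕ) (U Utilde : Set (Fin m → ℝ))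
    (hU : IsOpen U) (hUtilde : IsOpen Utilde) (h : U ⊆ Utilde) :
    letI : Algebra (Cinf m Utilde) (Cinf m U) := (CinfRes m U Utilde h).toAlgebra
    Module.Flat (Cinf m Utilde) (Cinf m U) := by
  let : Algebra (Cinf m Utilde) (Cinf m U) := (CinfRes m U Utilde h).toAlgebra
  have := Cinf.isLocalization hU h
  exact IsLocalization.flat _ ((IsUnit.submonoid (Cinf m U)).comap (CinfRes m U Utilde h))
end

section
/- Let Ũ ⊆ ℝᵐ be open with compact closure, U ⊆ Ũ open, and let I(Ũ) ⊆ C^∞(Ũ) and I(U) ⊆ C^∞(U) be ideals such that every element of I(U) is a C^∞(U)-linear combination of restrictions of finitely many elements of I(Ũ). Suppose f ∈ C^∞(U) satisfies |f(x)|^m ≤ |g(x)| for all x ∈ U, for some m ≥ 1 and g ∈ I(U). Then there exists α ∈ C^∞(Ũ) with α > 0 on U such that α·f extends to a function f' ∈ C^∞(Ũ) satisfying: for some m' ≥ 1 and some h in the ideal of C^∞(Ũ) generated by I(Ũ), |f'(x)|^{m'} ≤ |h(x)| for all x ∈ Ũ. -/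
open Set Function Filter Topology in
/-- A smooth function on an open set, multiplied by a smooth function whose topological support
lies in that set, is smooth everywhere. -/
theorem ContDiff.smul_contDiffOn_of_tsupport_subset
    {E F : Type*} [NormedAddCommGroup E] [NormedSpace ℝ E]
    [NormedAddCommGroup F] [NormedSpace ℝ F] {n : WithTop ℕ∞} {U : Set E} (hU : IsOpen U)
    {χ : E → ℝ} (hχ : ContDiff ℝ n χ) (hsupp : tsupport χ ⊆ U)
    {Φ : E → F} (hΦ : ContDiffOn ℝ n Φ U) : ContDiff ℝ n fun x => χ x • Φ x := by
  refine contDiff_iff_contDiffAt.2 fun x => ?_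
  by_cases hx : x ∈ tsupport χ
  · exact hχ.contDiffAt.smul (hΦ.contDiffAt (hU.mem_nhds (hsupp hx)))
  · refine (contDiffAt_const (c := (0 : F))).congr_of_eventuallyEq ?_
    filter_upwards [notMem_tsupport_iff_eventuallyEq.1 hx] with y hy
    simp [hy]

open Set Function Filter Topology in
/-- An open subset of a finite-dimensional space is the union of the supports of a sequence of
nonnegative smooth functions compactly supported inside it. -/
theorem IsOpen.exists_seq_contDiff_tsupport_subset
    {E : Type*} [NormedAddCommGroup E] [NormedSpace ℝ E] [FiniteDimensional ℝ E]
    {U : Set E} (hU : IsOpen U) :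
    ∃ χ : ℕ → E → ℝ, (∀ n, ContDiff ℝ (⊤ : ℕ∞) (χ n)) ∧ (∀ n, HasCompactSupport (χ n)) ∧
      (∀ n, tsupport (χ n) ⊆ U) ∧ (∀ n x, 0 ≤ χ n x) ∧ ∀ x ∈ U, ∃ n, 0 < χ n x := by
  rcases U.eq_empty_or_nonempty with rfl | hne
  · exact ⟨fun _ _ => 0, fun _ => contDiff_const, fun _ => HasCompactSupport.zero,
      fun _ => by simp [tsupport], fun _ _ => le_rfl, fun x hx => hx.elim⟩
  have bump : ∀ x : U, ∃ b : E → ℝ, tsupport b ⊆ U ∧ HasCompactSupport b ∧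
      ContDiff ℝ (⊤ : ℕ∞) b ∧ range b ⊆ Icc 0 1 ∧ b x = 1 := fun x =>
    exists_contDiff_tsupport_subset (hU.mem_nhds x.2)
  choose b b_supp b_compact b_smooth b_range b_self using bump
  obtain ⟨T, hT, hcover⟩ := TopologicalSpace.isOpen_iUnion_countable
    (fun x : U => support (b x)) fun x => (b_smooth x).continuous.isOpen_support
  have hmem : ∀ x ∈ U, ∃ y ∈ T, x ∈ support (b y) := by
    intro x hx
    have : x ∈ ⋃ y : U, support (b y) := mem_iUnion.2 ⟨⟨x, hx⟩, by simp [b_self ⟨x, hx⟩]⟩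
    rw [← hcover] at this
    simpa only [mem_iUnion, exists_prop] using this
  have hTne : T.Nonempty := by
    obtain ⟨x, hx⟩ := hne
    obtain ⟨y, hy, -⟩ := hmem x hx
    exact ⟨y, hy⟩
  obtain ⟨e, rfl⟩ := hT.exists_eq_range hTne
  have b_nonneg : ∀ y x, 0 ≤ b y x := fun y x => (b_range y (mem_range_self x)).1
  refine ⟨fun n => b (e n), fun n => b_smooth _, fun n => b_compact _, fun n => b_supp _,
    fun n => b_nonneg _, fun x hx => ?_⟩
  obtain ⟨_, ⟨n, rfl⟩, hn⟩ := hmem x hx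
  exact ⟨n, lt_of_le_of_ne (b_nonneg _ _) (Ne.symm hn)⟩

open Set Function Filter Topology in
/-- A smooth compactly supported function can be scaled by a positive constant so that its
derivatives up to a given order are uniformly small. -/
theorem ContDiff.exists_pos_norm_iteratedFDeriv_smul_le
    {E F : Type*} [NormedAddCommGroup E] [NormedSpace ℝ E]
    [NormedAddCommGroup F] [NormedSpace ℝ F] {G : E → F}
    (hsmooth : ContDiff ℝ (⊤ : ℕ∞) G) (hG : HasCompactSupport G) (n : ℕ) {δ : ℝ} (hδ : 0 < δ) :
    ∃ r : ℝ, 0 < r ∧ ∀ i ≤ n, ∀ x, ‖iteratedFDeriv ℝ i (r • G) x‖ ≤ δ := by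
  have bound : ∀ i, ∃ R, ∀ x, ‖iteratedFDeriv ℝ i G x‖ ≤ R := by
    intro i
    have : BddAbove (range fun x => ‖iteratedFDeriv ℝ i G x‖) :=
      (hsmooth.continuous_iteratedFDeriv (mod_cast le_top)).norm.bddAbove_range_of_hasCompactSupport
        ((hG.iteratedFDeriv i).comp_left norm_zero)
    obtain ⟨R, hR⟩ := this
    exact ⟨R, fun x => hR (mem_range_self x)⟩
  choose R hR using bound
  let M : ℝ := 1 + ∑ i ∈ Finset.range (n + 1), |R i|
  have hM : 0 < M := by positivity
  have hRM : ∀ i ≤ n, R i ≤ M := fun i hi => by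
    have := Finset.single_le_sum (f := fun i => |R i|) (fun i _ => abs_nonneg _)
      (Finset.mem_range.2 (Nat.lt_succ_of_le hi))
    have := le_abs_self (R i)
    simp only [M]
    linarith
  refine ⟨M⁻¹ * δ, by positivity, fun i hi x => ?_⟩
  rw [iteratedFDeriv_const_smul_apply (hsmooth.contDiffAt.of_le (mod_cast le_top)),
    norm_smul _ (iteratedFDeriv ℝ i G x), Real.norm_of_nonneg (by positivity)]
  calc M⁻¹ * δ * ‖iteratedFDeriv ℝ i G x‖ ≤ M⁻¹ * δ * M := by
        gcongr
        exact (hR i x).trans (hRM i hi)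
    _ = δ := by field_simp

open Set Function Filter Topology in
/-- Tougeron's extension lemma: given a smooth map `Φ` on an open set `U`, there is a smooth
nonnegative function `α` with support `U` such that `α • Φ` is smooth everywhere. -/
theorem IsOpen.exists_contDiff_support_eq_contDiff_smul
    {E F : Type*} [NormedAddCommGroup E] [NormedSpace ℝ E] [FiniteDimensional ℝ E]
    [NormedAddCommGroup F] [NormedSpace ℝ F] [CompleteSpace F] {U : Set E} (hU : IsOpen U)
    {Φ : E → F} (hΦ : ContDiffOn ℝ (⊤ : ℕ∞) Φ U) :
    ∃ α : E → ℝ, ContDiff ℝ (⊤ : ℕ∞) α ∧ (∀ x, 0 ≤ α x) ∧ support α = U ∧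
      ContDiff ℝ (⊤ : ℕ∞) fun x => α x • Φ x := by
  obtain ⟨χ, χ_smooth, χ_compact, χ_supp, χ_nonneg, χ_pos⟩ :=
    hU.exists_seq_contDiff_tsupport_subset
  let G : ℕ → E → ℝ × F := fun n x => χ n x • ((1 : ℝ), Φ x)
  have G_smooth : ∀ n, ContDiff ℝ (⊤ : ℕ∞) (G n) := fun n =>
    (χ_smooth n).smul_contDiffOn_of_tsupport_subset hU (χ_supp n) (contDiffOn_const.prodMk hΦ)
  have G_compact : ∀ n, HasCompactSupport (G n) := fun n => (χ_compact n).smul_right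
  have scale : ∀ n : ℕ, ∃ r : ℝ, 0 < r ∧
      ∀ i ≤ n, ∀ x, ‖iteratedFDeriv ℝ i (r • G n) x‖ ≤ (1 / 2 : ℝ) ^ n := fun n =>
    (G_smooth n).exists_pos_norm_iteratedFDeriv_smul_le (G_compact n) n (by positivity)
  choose r r_pos hr using scale
  have smooth : ContDiff ℝ (⊤ : ℕ∞) fun x => ∑' n, (r n • G n) x := by
    refine contDiff_tsum_of_eventually (v := fun _ n => (1 / 2 : ℝ) ^ n)
      (fun n => (G_smooth n).const_smul (r n)) (fun _ _ => summable_geometric_two) fun i _ => ?_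
    rw [Nat.cofinite_eq_atTop]
    filter_upwards [eventually_ge_atTop i] with n hn x using hr n i hn x
  have summable : ∀ x, Summable fun n => (r n • G n) x := fun x =>
    .of_norm_bounded summable_geometric_two fun n => by
      simpa only [norm_iteratedFDeriv_zero] using hr n 0 (Nat.zero_le n) x
  let α : E → ℝ := fun x => ∑' n, r n * χ n x
  have summable_α : ∀ x, Summable fun n => r n * χ n x := fun x => by
    simpa [G] using (ContinuousLinearMap.fst ℝ ℝ F).summable (summable x)
  have sum_eq : ∀ x, ∑' n, (r n • G n) x = (α x, α x • Φ x) := fun x => by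
    have h := ((summable_α x).hasSum.smul_const ((1 : ℝ), Φ x)).tsum_eq
    simpa [G, smul_smul] using h
  simp only [sum_eq] at smooth
  have term_nonneg : ∀ x n, 0 ≤ r n * χ n x := fun x n =>
    mul_nonneg (r_pos n).le (χ_nonneg n x)
  refine ⟨α, smooth.fst, fun x => tsum_nonneg (term_nonneg x), ?_, smooth.snd⟩
  refine Subset.antisymm (fun x hx => ?_) fun x hx => ?_
  · contrapose! hx
    have : ∀ n, χ n x = 0 := fun n =>
      notMem_support.1 fun h => hx (χ_supp n (subset_tsupport _ h))
    simp [α, this]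
  · obtain ⟨n, hn⟩ := χ_pos x hx
    exact ((summable_α x).tsum_pos (term_nonneg x) n (mul_pos (r_pos n) hn)).ne'


/-- Key step in proving that the real-radical closure of a quasi-flasque ideal sheaf is
quasi-flasque: let `U ⊆ Ũ` be open in `ℝᵐ` with `closure Ũ` compact, let `IŨ` be a
family of smooth functions on `Ũ` (generating an ideal of `C^∞(Ũ)`), and suppose
`f ∈ C^∞(U)` satisfies `|f|^m ≤ |g|` on `U` where `g` is a `C^∞(U)`-combination of
restrictions of elements of `IŨ`.  Then there are `α ∈ C^∞(Ũ)`, positive on `U`, and an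
extension `f' ∈ C^∞(Ũ)` of `α·f` satisfying a Łojasiewicz inequality `|f'|^{m'} ≤ |h|`
on all of `Ũ` with `h` in the ideal of `C^∞(Ũ)` generated by `IŨ`. -/
theorem realRad_globalize (k : ℕ) (U Utilde : Set (Fin k → ℝ))
    (hU : IsOpen U) (hUtilde : IsOpen Utilde) (hsub : U ⊆ Utilde)
    (hcpt : IsCompact (closure Utilde))
    (ISet : Set ((Fin k → ℝ) → ℝ)) (hISet : ∀ g ∈ ISet, ContDiffOn ℝ (⊤ : ℕ∞) g Utilde)
    (f g : (Fin k → ℝ) → ℝ) (hf : ContDiffOn ℝ (⊤ : ℕ∞) f U)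
    (hg : ∃ (t : ℕ) (φ : Fin t → (Fin k → ℝ) → ℝ) (G : Fin t → (Fin k → ℝ) → ℝ),
      (∀ i, G i ∈ ISet) ∧ (∀ i, ContDiffOn ℝ (⊤ : ℕ∞) (φ i) U) ∧
      ∀ x ∈ U, g x = ∑ i, φ i x * G i x)
    (m : ℕ) (hm : 1 ≤ m) (hineq : ∀ x ∈ U, |f x| ^ m ≤ |g x|) :
    ∃ α f' : (Fin k → ℝ) → ℝ, ContDiffOn ℝ (⊤ : ℕ∞) α Utilde ∧ (∀ x ∈ U, 0 < α x) ∧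
      ContDiffOn ℝ (⊤ : ℕ∞) f' Utilde ∧ (∀ x ∈ U, f' x = α x * f x) ∧
      ∃ m' : ℕ, 1 ≤ m' ∧ ∃ h : (Fin k → ℝ) → ℝ,
        (∃ (s : ℕ) (ψ : Fin s → (Fin k → ℝ) → ℝ) (H : Fin s → (Fin k → ℝ) → ℝ),
          (∀ i, H i ∈ ISet) ∧ (∀ i, ContDiffOn ℝ (⊤ : ℕ∞) (ψ i) Utilde) ∧
          ∀ x ∈ Utilde, h x = ∑ i, ψ i x * H i x) ∧
        ∀ x ∈ Utilde, |f' x| ^ m' ≤ |h x| := by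
  obtain ⟨t, φ, G, hG, hφ, hsum⟩ := hg
  obtain ⟨α, hα, α_nonneg, α_supp, hαΦ⟩ := hU.exists_contDiff_support_eq_contDiff_smul
    (hf.prodMk (contDiffOn_pi.2 hφ))
  have hαf : ContDiff ℝ (⊤ : ℕ∞) fun x => α x * f x := hαΦ.fst
  have hαφ : ∀ i, ContDiff ℝ (⊤ : ℕ∞) fun x => α x * φ i x := contDiff_pi.1 hαΦ.snd
  refine ⟨α, fun x => α x * f x, hα.contDiffOn,
    fun x hx => (α_nonneg x).lt_of_ne' (α_supp.symm ▸ hx : x ∈ Function.support α),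
    hαf.contDiffOn, fun _ _ => rfl, m, hm,
    fun x => ∑ i, α x ^ (m - 1) * (α x * φ i x) * G i x,
    ⟨t, fun i x => α x ^ (m - 1) * (α x * φ i x), G, hG,
      fun i => ((hα.pow _).mul (hαφ i)).contDiffOn, fun _ _ => rfl⟩, fun x _ => ?_⟩
  by_cases hx : x ∈ U
  · have key : ∑ i, α x ^ (m - 1) * (α x * φ i x) * G i x = α x ^ m * g x := by
      rw [hsum x hx, Finset.mul_sum]
      refine Finset.sum_congr rfl fun i _ => ?_
      rw [← pow_sub_one_mul (Nat.one_le_iff_ne_zero.1 hm) (α x)]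
      ring
    beta_reduce
    rw [key, abs_mul, abs_mul, abs_pow, mul_pow]
    gcongr
    exact hineq x hx
  · have : α x = 0 := Function.notMem_support.1 (α_supp ▸ hx)
    simp [this, Nat.one_le_iff_ne_zero.1 hm]
end
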